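/- For every natural number t and every real c with −1/2 < c < 0, the function y ↦ h(c+iy) is integrable over ℝ and (1/(2π)) ∫_{−∞}^{∞} h(c+iy) dy = (1/π) · (1)_t / (1/2)_t, where h(s) = [(1/2)_s (1/2+t)_s^2 / ((1)_s (1+2t)_s)] · (3s+2t+1) · Γ(−s) · 2^{3s}. -/

import Mathlib

open Complex MeasureTheory Real

/-- Rising factorial `(a)ₙ` for real `a` and natural `n`. -/
noncomputable def pochR (a : ℝ) (n : ℕ) : ℝ := ∏ i ∈ Finset.range n, (a + i)

/-- Complex rising factorial `(a)ₛ = Γ(a+s)/Γ(a)`. -/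
noncomputable def cpoch (a s : ℂ) : ℂ := Complex.Gamma (a + s) / Complex.Gamma a

/-- Complex power of a positive real base: `b^s = exp(s · log b)` with the real logarithm. -/
noncomputable def cpowR (b : ℝ) (s : ℂ) : ℂ := Complex.exp (s * (Real.log b : ℂ))

/-- The integrand `h` (depending on the natural parameter `t`). -/
noncomputable def h6 (t : ℕ) (s : ℂ) : ℂ :=
  (cpoch (1/2) s * cpoch (1/2 + (t : ℂ)) s ^ 2 /
      (cpoch 1 s * cpoch (1 + 2*(t : ℂ)) s)) *
    (3*s + 2*(t : ℂ) + 1) * Complex.Gamma (-s) * cpowR 2 (3*s)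

open Filter Topology

lemma norm_Gamma_le_re {s : ℂ} (hs : 0 < s.re) : ‖Complex.Gamma s‖ ≤ Real.Gamma s.re := by
  rw [Complex.Gamma_eq_integral hs, Real.Gamma_eq_integral hs, Complex.GammaIntegral]
  refine (norm_integral_le_integral_norm _).trans (le_of_eq ?_)
  refine setIntegral_congr_fun measurableSet_Ioi ?_
  intro x hx
  have hx : 0 < x := hx
  simp only [norm_mul, Complex.norm_real, Complex.norm_cpow_eq_rpow_re_of_pos hx]
  simp [abs_of_pos (Real.exp_pos _)]

lemma norm_beta_le {u v : ℂ} (hu : 0 < u.re) (hv : 0 < v.re) :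
    ‖Complex.Gamma u * Complex.Gamma v / Complex.Gamma (u + v)‖ ≤
      Real.Gamma u.re * Real.Gamma v.re / Real.Gamma (u.re + v.re) := by
  have h2 := Complex.betaIntegral_eq_Gamma_mul_div (u.re : ℂ) (v.re : ℂ)
    (by simpa using hu) (by simpa using hv)
  rw [← Complex.betaIntegral_eq_Gamma_mul_div u v hu hv]
  have h3 : Complex.betaIntegral (u.re : ℂ) (v.re : ℂ) =
      ((∫ x : ℝ in (0:ℝ)..1, x ^ (u.re - 1) * (1 - x) ^ (v.re - 1) : ℝ) : ℂ) := by
    rw [Complex.betaIntegral, ← intervalIntegral.integral_ofReal]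
    refine intervalIntegral.integral_congr ?_
    intro x hx
    rw [Set.uIcc_of_le zero_le_one] at hx
    simp only [Complex.ofReal_mul]
    rw [Complex.ofReal_cpow hx.1, Complex.ofReal_cpow (by linarith [hx.2])]
    push_cast
    rfl
  have h4 : (∫ x : ℝ in (0:ℝ)..1, x ^ (u.re - 1) * (1 - x) ^ (v.re - 1) : ℝ) =
      Real.Gamma u.re * Real.Gamma v.re / Real.Gamma (u.re + v.re) := by
    apply Complex.ofReal_injective
    rw [← h3, h2]
    push_cast [← Complex.Gamma_ofReal]
    rfl
  rw [← h4, Complex.betaIntegral]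
  refine (intervalIntegral.norm_integral_le_integral_norm zero_le_one).trans (le_of_eq ?_)
  rw [intervalIntegral.integral_of_le zero_le_one, intervalIntegral.integral_of_le zero_le_one,
    integral_Ioc_eq_integral_Ioo, integral_Ioc_eq_integral_Ioo]
  refine setIntegral_congr_fun measurableSet_Ioo ?_
  intro x hx
  have h1x : 0 < 1 - x := by linarith [hx.2]
  have e : (1 - (x : ℂ)) = ((1 - x : ℝ) : ℂ) := by push_cast; rfl
  simp only [norm_mul, e, Complex.norm_cpow_eq_rpow_re_of_pos hx.1,
    Complex.norm_cpow_eq_rpow_re_of_pos h1x]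
  simp

lemma integrable_line {F : ℝ → ℂ} (hc : Continuous F) (C : ℝ)
    (hC : ∀ y : ℝ, 1 ≤ |y| → ‖F y‖ ≤ C / y ^ 2) : Integrable F := by
  obtain ⟨M, hM⟩ := (isCompact_Icc (a := (-1:ℝ)) (b := 1)).exists_bound_of_continuousOn
    hc.continuousOn
  have hM0 : 0 ≤ M := (norm_nonneg _).trans (hM 0 (by constructor <;> norm_num))
  have hC0 : 0 ≤ C := by simpa using (norm_nonneg _).trans (hC 1 (by norm_num))
  refine Integrable.mono' ((integrable_inv_one_add_sq).const_mul (2 * (M + C)))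
    hc.aestronglyMeasurable (ae_of_all _ fun y => ?_)
  rcases le_total 1 |y| with h | h
  · refine (hC y h).trans ?_
    have : 1 ≤ y ^ 2 := by rw [← sq_abs]; nlinarith
    rw [← div_eq_mul_inv, div_le_div_iff₀ (by linarith) (by linarith)]
    nlinarith
  · refine (hM y (abs_le.mp h)).trans ?_
    have : y ^ 2 ≤ 1 := by rw [← sq_abs]; nlinarith [abs_nonneg y]
    rw [← div_eq_mul_inv, le_div_iff₀ (by positivity)]
    nlinarith

lemma line_continuous {f : ℂ → ℂ} {c : ℝ}
    (hd : ∀ s : ℂ, s.re = c → DifferentiableAt ℂ f s) :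
    Continuous (fun y : ℝ => f ((c : ℂ) + (y : ℂ) * Complex.I)) := by
  rw [continuous_iff_continuousAt]
  intro y
  have h1 : ContinuousAt f ((c : ℂ) + (y : ℂ) * Complex.I) := (hd _ (by simp)).continuousAt
  exact ContinuousAt.comp (f := fun y : ℝ => ((c : ℂ) + (y : ℂ) * Complex.I)) h1 (by fun_prop)

lemma line_integrable {f : ℂ → ℂ} {c : ℝ}
    (hd : ∀ s : ℂ, s.re = c → DifferentiableAt ℂ f s) (C : ℝ)
    (hC : ∀ s : ℂ, s.re = c → 1 ≤ |s.im| → ‖f s‖ ≤ C / s.im ^ 2) :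
    Integrable (fun y : ℝ => f ((c : ℂ) + (y : ℂ) * Complex.I)) := by
  refine integrable_line (line_continuous hd) C fun y hy => ?_
  simpa using hC ((c : ℂ) + (y : ℂ) * Complex.I) (by simp) (by simpa using hy)

lemma shift_line {f : ℂ → ℂ} {a b : ℝ} (hab : a ≤ b)
    (hd : ∀ s : ℂ, a ≤ s.re → s.re ≤ b → DifferentiableAt ℂ f s) (C : ℝ)
    (hC : ∀ s : ℂ, a ≤ s.re → s.re ≤ b → 1 ≤ |s.im| → ‖f s‖ ≤ C / s.im ^ 2) :
    ∫ y : ℝ, f ((a : ℂ) + (y : ℂ) * Complex.I) = ∫ y : ℝ, f ((b : ℂ) + (y : ℂ) * Complex.I) := by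
  have ia := line_integrable (f := f) (c := a) (fun s h => hd s h.ge (h.le.trans hab)) C
    (fun s h => hC s h.ge (h.le.trans hab))
  have ib := line_integrable (f := f) (c := b) (fun s h => hd s (hab.trans h.ge) h.le) C
    (fun s h => hC s (hab.trans h.ge) h.le)
  have ta := intervalIntegral_tendsto_integral ia tendsto_neg_atTop_atBot tendsto_id
  have tb := intervalIntegral_tendsto_integral ib tendsto_neg_atTop_atBot tendsto_id
  have key : ∀ T : ℝ, (∫ x : ℝ in a..b, f (x + ((-T : ℝ) : ℂ) * Complex.I)) -
      (∫ x : ℝ in a..b, f (x + (T : ℂ) * Complex.I)) =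
      Complex.I * (∫ y : ℝ in (-T)..T, f (a + y * Complex.I)) -
      Complex.I * (∫ y : ℝ in (-T)..T, f (b + y * Complex.I)) := by
    intro T
    have := Complex.integral_boundary_rect_eq_zero_of_differentiableOn f
      ⟨a, -T⟩ ⟨b, T⟩ (by
        intro s hs
        have hs := hs.1
        simp only [Set.mem_preimage, Set.uIcc_of_le hab] at hs
        exact (hd s hs.1 hs.2).differentiableWithinAt)
    simp only [smul_eq_mul] at this
    linear_combination this
  have hor : ∀ T : ℝ, 1 ≤ |T| → ‖∫ x : ℝ in a..b, f (x + (T : ℂ) * Complex.I)‖ ≤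
      C / T ^ 2 * |b - a| := by
    intro T hT
    refine intervalIntegral.norm_integral_le_of_norm_le_const fun x hx => ?_
    rw [Set.uIoc_of_le hab] at hx
    simpa using hC ((x : ℂ) + (T : ℂ) * Complex.I) (by simpa using hx.1.le) (by simpa using hx.2)
      (by simpa using hT)
  have t0 : Tendsto (fun T : ℝ => C / T ^ 2 * |b - a|) atTop (𝓝 0) := by
    have : Tendsto (fun T : ℝ => C / T ^ 2) atTop (𝓝 0) :=
      tendsto_const_nhds.div_atTop (tendsto_pow_atTop (by norm_num))
    simpa using this.mul_const |b - a|
  have t1 : Tendsto (fun T : ℝ => ∫ x : ℝ in a..b, f (x + (T : ℂ) * Complex.I)) atTop (𝓝 0) := by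
    refine squeeze_zero_norm' ?_ t0
    filter_upwards [eventually_ge_atTop 1] with T hT
    exact hor T (hT.trans (le_abs_self T))
  have t2 : Tendsto (fun T : ℝ => ∫ x : ℝ in a..b, f (x + ((-T : ℝ) : ℂ) * Complex.I))
      atTop (𝓝 0) := by
    refine squeeze_zero_norm' ?_ t0
    filter_upwards [eventually_ge_atTop 1] with T hT
    have := hor (-T) (by rw [abs_neg]; exact hT.trans (le_abs_self T))
    simpa using this
  have t3 := t2.sub t1
  have t4 := (ta.const_mul Complex.I).sub (tb.const_mul Complex.I)
  have t5 := t3.congr key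
  have e := tendsto_nhds_unique t4 t5
  rw [sub_zero, sub_eq_zero] at e
  exact mul_left_cancel₀ Complex.I_ne_zero e

lemma integral_u {u : ℝ} (hu : u ≠ 0) :
    Integrable (fun y : ℝ => u / (u ^ 2 + y ^ 2)) ∧
    ∫ y : ℝ, u / (u ^ 2 + y ^ 2) = u⁻¹ * (|u| * π) := by
  have e : (fun y : ℝ => u / (u ^ 2 + y ^ 2)) = fun y => u⁻¹ * (1 + (y / u) ^ 2)⁻¹ := by
    ext y
    have : u ^ 2 + y ^ 2 ≠ 0 := by positivity
    field_simp
  rw [e]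
  constructor
  · exact (integrable_inv_one_add_sq.comp_div hu).const_mul _
  · rw [integral_const_mul, Measure.integral_comp_div (fun y : ℝ => (1 + y ^ 2)⁻¹) u,
      integral_univ_inv_one_add_sq, smul_eq_mul]

lemma integral_k {c : ℝ} (h1 : -3/2 < c) (h2 : c ≠ -1/2) :
    Integrable (fun y : ℝ => 1 / (((c : ℂ) + (y : ℂ) * Complex.I + 1/2) *
      ((c : ℂ) + (y : ℂ) * Complex.I + 3/2))) ∧
    ∫ y : ℝ, 1 / (((c : ℂ) + (y : ℂ) * Complex.I + 1/2) *
      ((c : ℂ) + (y : ℂ) * Complex.I + 3/2)) =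
      (((c + 1/2)⁻¹ * |c + 1/2| - 1) * π : ℝ) := by
  set F : ℝ → ℂ := fun y : ℝ => 1 / (((c : ℂ) + (y : ℂ) * Complex.I + 1/2) *
      ((c : ℂ) + (y : ℂ) * Complex.I + 3/2)) with hF
  have hu : c + 1/2 ≠ 0 := by intro h; apply h2; linarith
  have hv : 0 < c + 3/2 := by linarith
  have n1 : ∀ y : ℝ, (c : ℂ) + (y : ℂ) * Complex.I + 1/2 ≠ 0 := by
    intro y h
    have := congrArg Complex.re h
    simp at this
    exact hu (by linarith)
  have n2 : ∀ y : ℝ, (c : ℂ) + (y : ℂ) * Complex.I + 3/2 ≠ 0 := by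
    intro y h
    have := congrArg Complex.re h
    simp at this
    linarith
  have hcont : Continuous F := by
    rw [hF]
    refine Continuous.div (by fun_prop) (by fun_prop) fun y => mul_ne_zero (n1 y) (n2 y)
  have hFint : Integrable F := by
    refine integrable_line hcont 1 fun y hy => ?_
    have b1 : |y| ≤ ‖(c : ℂ) + (y : ℂ) * Complex.I + 1/2‖ := by
      simpa using Complex.abs_im_le_norm ((c : ℂ) + (y : ℂ) * Complex.I + 1/2)
    have b2 : |y| ≤ ‖(c : ℂ) + (y : ℂ) * Complex.I + 3/2‖ := by
      simpa using Complex.abs_im_le_norm ((c : ℂ) + (y : ℂ) * Complex.I + 3/2)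
    rw [hF]
    simp only [norm_div, norm_mul, norm_one]
    rw [← sq_abs y, sq]
    have : 0 < |y| := by linarith
    gcongr
  refine ⟨hFint, ?_⟩
  have hneg : ∫ y : ℝ, F (-y) = ∫ y : ℝ, F y := integral_neg_eq_self F volume
  have hsum : ∫ y : ℝ, (F y + F (-y)) = 2 * ∫ y : ℝ, F y := by
    rw [integral_add hFint hFint.comp_neg, hneg]; ring
  have hreal : ∀ y : ℝ, F y + F (-y) =
      ((2 * ((c + 1/2) / ((c + 1/2) ^ 2 + y ^ 2) - (c + 3/2) / ((c + 3/2) ^ 2 + y ^ 2)) : ℝ) : ℂ) := by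
    intro y
    have m1 := n1 y
    have m2 := n2 y
    have m3 := n1 (-y)
    have m4 := n2 (-y)
    have I2 := Complex.I_sq
    push_cast at m3 m4
    have d1 : ((c : ℂ) + 1/2) ^ 2 + (y : ℂ) ^ 2 =
        ((c : ℂ) + (y : ℂ) * Complex.I + 1/2) * ((c : ℂ) + (-(y : ℂ)) * Complex.I + 1/2) := by
      linear_combination ((y : ℂ) ^ 2) * I2
    have d2 : ((c : ℂ) + 3/2) ^ 2 + (y : ℂ) ^ 2 =
        ((c : ℂ) + (y : ℂ) * Complex.I + 3/2) * ((c : ℂ) + (-(y : ℂ)) * Complex.I + 3/2) := by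
      linear_combination ((y : ℂ) ^ 2) * I2
    have p1 : 1 / (((c : ℂ) + (y : ℂ) * Complex.I + 1/2) * ((c : ℂ) + (y : ℂ) * Complex.I + 3/2)) =
      1 / ((c : ℂ) + (y : ℂ) * Complex.I + 1/2) - 1 / ((c : ℂ) + (y : ℂ) * Complex.I + 3/2) := by
      rw [div_sub_div _ _ m1 m2]; congr 1; ring
    have p2 : 1 / (((c : ℂ) + (-(y : ℂ)) * Complex.I + 1/2) *
        ((c : ℂ) + (-(y : ℂ)) * Complex.I + 3/2)) =
      1 / ((c : ℂ) + (-(y : ℂ)) * Complex.I + 1/2) -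
        1 / ((c : ℂ) + (-(y : ℂ)) * Complex.I + 3/2) := by
      rw [div_sub_div _ _ m3 m4]; congr 1; ring
    have q1 : 1 / ((c : ℂ) + (y : ℂ) * Complex.I + 1/2) +
        1 / ((c : ℂ) + (-(y : ℂ)) * Complex.I + 1/2) =
        2 * (((c : ℂ) + 1/2) / (((c : ℂ) + 1/2) ^ 2 + (y : ℂ) ^ 2)) := by
      rw [d1, div_add_div _ _ m1 m3, ← mul_div_assoc]; congr 1; ring
    have q2 : 1 / ((c : ℂ) + (y : ℂ) * Complex.I + 3/2) +
        1 / ((c : ℂ) + (-(y : ℂ)) * Complex.I + 3/2) =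
        2 * (((c : ℂ) + 3/2) / (((c : ℂ) + 3/2) ^ 2 + (y : ℂ) ^ 2)) := by
      rw [d2, div_add_div _ _ m2 m4, ← mul_div_assoc]; congr 1; ring
    simp only [hF]
    push_cast
    rw [p1, p2]
    linear_combination q1 - q2
  rw [funext hreal, integral_complex_ofReal, integral_const_mul,
    integral_sub (integral_u hu).1 (integral_u hv.ne').1, (integral_u hu).2,
    (integral_u hv.ne').2, abs_of_pos hv] at hsum
  have : (2 : ℂ) ≠ 0 := two_ne_zero
  apply mul_left_cancel₀ this
  rw [← hsum]
  push_cast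
  have : (c : ℂ) + 3/2 ≠ 0 := by simpa using n2 0
  linear_combination (-2 * (π : ℂ)) * inv_mul_cancel₀ this

lemma residue_shift {g : ℂ → ℂ} {a b : ℝ} (ha : -3/2 < a) (ha2 : a < -1/2) (hb : -1/2 < b)
    (hd : ∀ s : ℂ, a ≤ s.re → s.re ≤ b → DifferentiableAt ℂ g s) (C : ℝ)
    (hC : ∀ s : ℂ, a ≤ s.re → s.re ≤ b → 1 ≤ |s.im| → ‖g s‖ ≤ C / s.im ^ 2) :
    ∫ y : ℝ, g ((b : ℂ) + (y : ℂ) * Complex.I) / ((b : ℂ) + (y : ℂ) * Complex.I + 1/2) =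
    (∫ y : ℝ, g ((a : ℂ) + (y : ℂ) * Complex.I) / ((a : ℂ) + (y : ℂ) * Complex.I + 1/2)) +
      2 * π * g (-1/2) := by
  have hab : a ≤ b := by linarith
  have hC0 : 0 ≤ C := by
    have := (norm_nonneg _).trans (hC ((a : ℂ) + Complex.I) (by simp) (by simpa using hab) (by simp))
    simpa using this
  have ne1 : ∀ s : ℂ, s.re ≠ -1/2 → s + 1/2 ≠ 0 := by
    intro s hs h
    have := congrArg Complex.re h
    simp at this
    apply hs; linarith
  have ne3 : ∀ s : ℂ, a ≤ s.re → s + 3/2 ≠ 0 := by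
    intro s hs h
    have := congrArg Complex.re h
    simp at this
    linarith
  set G : ℂ → ℂ := fun s => g s * (s + 3/2) with hG
  set φ : ℂ → ℂ := fun s => dslope G (-1/2) s / (s + 3/2) with hφ
  have hφe : ∀ s : ℂ, a ≤ s.re → s + 1/2 ≠ 0 → φ s = g s / (s + 1/2) -
      g (-1/2) * (1 / ((s + 1/2) * (s + 3/2))) := by
    intro s h3 h
    have h3 := ne3 s h3
    have hs : s ≠ -1/2 := by rintro rfl; apply h; ring
    simp only [hφ, dslope_of_ne _ hs, hG, slope_def_field]
    have e : s - -1/2 = s + 1/2 := by ring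
    rw [e, show (-1/2 : ℂ) + 3/2 = 1 by norm_num, div_div, mul_one, mul_one_div, sub_div,
      mul_div_mul_right _ _ h3]
  have hφd : ∀ s : ℂ, a ≤ s.re → s.re ≤ b → DifferentiableAt ℂ φ s := by
    intro s h1 h2
    have hGd : ∀ s : ℂ, a ≤ s.re → s.re ≤ b → DifferentiableAt ℂ G s := fun s h1 h2 =>
      (hd s h1 h2).mul (by fun_prop)
    have : DifferentiableAt ℂ (dslope G (-1/2)) s := by
      by_cases hs : s = -1/2
      · subst hs
        have hU : {z : ℂ | a < z.re ∧ z.re < b} ∈ 𝓝 (-1/2 : ℂ) := by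
          refine IsOpen.mem_nhds ?_ ?_
          · exact (isOpen_lt continuous_const Complex.continuous_re).inter
              (isOpen_lt Complex.continuous_re continuous_const)
          · constructor
            · simp; linarith
            · simp; linarith
        have := (Complex.differentiableOn_dslope (f := G) hU).mpr
          (fun z hz => (hGd z hz.1.le hz.2.le).differentiableWithinAt)
        exact this.differentiableAt hU
      · exact (differentiableAt_dslope_of_ne hs).mpr (hGd s h1 h2)
    exact this.div (by fun_prop) (ne3 s h1)
  have nb : ∀ s : ℂ, 1 ≤ |s.im| → |s.im| ≤ ‖s + 1/2‖ ∧ |s.im| ≤ ‖s + 3/2‖ := by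
    intro s _
    constructor
    · simpa using Complex.abs_im_le_norm (s + 1/2)
    · simpa using Complex.abs_im_le_norm (s + 3/2)
  have hg1 : ∀ s : ℂ, a ≤ s.re → s.re ≤ b → 1 ≤ |s.im| → ‖g s / (s + 1/2)‖ ≤ C / s.im ^ 2 := by
    intro s h1 h2 h3
    rw [norm_div]
    exact (div_le_self (norm_nonneg _) (h3.trans (nb s h3).1)).trans (hC s h1 h2 h3)
  have hsh := shift_line hab hφd (C + ‖g (-1/2)‖) (by
    intro s h1 h2 h3
    have hn : s + 1/2 ≠ 0 := by
      intro h
      have := (nb s h3).1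
      rw [h, norm_zero] at this
      linarith
    rw [hφe s h1 hn, add_div]
    refine (norm_sub_le _ _).trans (add_le_add (hg1 s h1 h2 h3) ?_)
    rw [norm_mul, norm_div, norm_mul, norm_one, mul_one_div, ← sq_abs s.im, sq]
    have : 0 < |s.im| := by linarith
    have := (nb s h3).1
    have := (nb s h3).2
    gcongr)
  have line : ∀ c : ℝ, a ≤ c → c ≤ b → c ≠ -1/2 →
      ∫ y : ℝ, φ ((c : ℂ) + (y : ℂ) * Complex.I) =
      (∫ y : ℝ, g ((c : ℂ) + (y : ℂ) * Complex.I) / ((c : ℂ) + (y : ℂ) * Complex.I + 1/2)) -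
      g (-1/2) * (((c + 1/2)⁻¹ * |c + 1/2| - 1) * π : ℝ) := by
    intro c h1 h2 h3
    have ik := integral_k (c := c) (by linarith) h3
    have ig : Integrable (fun y : ℝ => g ((c : ℂ) + (y : ℂ) * Complex.I) /
        ((c : ℂ) + (y : ℂ) * Complex.I + 1/2)) := by
      refine line_integrable (f := fun s => g s / (s + 1/2)) (c := c) ?_ C ?_
      · intro s hs
        exact (hd s (by rw [hs]; exact h1) (by rw [hs]; exact h2)).div (by fun_prop)
          (ne1 s (by rw [hs]; exact h3))
      · intro s hs
        exact hg1 s (by rw [hs]; exact h1) (by rw [hs]; exact h2)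
    rw [← ik.2, ← integral_const_mul, ← integral_sub ig (ik.1.const_mul _)]
    congr 1
    ext y
    exact hφe _ (by simpa using h1) (ne1 _ (by simpa using h3))
  rw [line a le_rfl hab ha2.ne, line b hab le_rfl hb.ne'] at hsh
  rw [abs_of_neg (by linarith), abs_of_pos (by linarith)] at hsh
  have ea : (a + 1/2)⁻¹ * -(a + 1/2) = -1 := by
    have : a + 1/2 ≠ 0 := by intro h; linarith
    rw [mul_neg, inv_mul_cancel₀ this]
  have eb : (b + 1/2)⁻¹ * (b + 1/2) = 1 := inv_mul_cancel₀ (by intro h; linarith)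
  rw [ea, eb] at hsh
  push_cast at hsh
  linear_combination -hsh

/-- The quotient `Γ(s+1/2+t)² / Γ(s+1+2t)`. -/
noncomputable def KK (t : ℕ) (s : ℂ) : ℂ :=
  Complex.Gamma (s + 1/2 + t) ^ 2 / Complex.Gamma (s + 1 + 2 * t)

/-- The part of the integrand not depending on `t`. -/
noncomputable def PP (s : ℂ) : ℂ :=
  Complex.Gamma (s + 3/2) / Complex.Gamma (s + 2) * Complex.Gamma (1 - s) * cpowR 2 (3 * s)

lemma KK_bound {t : ℕ} {s : ℂ} (hs : 0 < s.re + 1/2 + t) :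
    ‖KK t s‖ ≤ Real.Gamma (s.re + 1/2 + t) ^ 2 / Real.Gamma (s.re + 1 + 2 * t) := by
  have r1 : (s + 1/2 + t : ℂ).re = s.re + 1/2 + t := by simp
  have r2 : (1/2 + t : ℂ).re = 1/2 + t := by simp
  have p2 : (0:ℝ) < 1/2 + t := by positivity
  have hb := norm_beta_le (u := s + 1/2 + t) (v := 1/2 + t) (by rw [r1]; exact hs)
    (by rw [r2]; exact p2)
  have hg := norm_Gamma_le_re (s := s + 1/2 + t) (by rw [r1]; exact hs)
  rw [r1] at hg
  rw [r1, r2] at hb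
  have g2 : Complex.Gamma (1/2 + t) = (Real.Gamma (1/2 + t) : ℂ) := by
    rw [← Complex.Gamma_ofReal]; push_cast; rfl
  have gp : 0 < Real.Gamma (1/2 + t) := Real.Gamma_pos_of_pos p2
  have gn : (Real.Gamma (1/2 + t) : ℂ) ≠ 0 := by exact_mod_cast gp.ne'
  have e : KK t s = (Complex.Gamma (s + 1/2 + t) * Complex.Gamma (1/2 + t) /
      Complex.Gamma (s + 1/2 + t + (1/2 + t))) *
      (Complex.Gamma (s + 1/2 + t) / (Real.Gamma (1/2 + t) : ℂ)) := by
    rw [KK, g2, show s + 1/2 + t + (1/2 + t : ℂ) = s + 1 + 2 * t by ring]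
    rw [div_mul_div_comm, sq, show Complex.Gamma (s + 1/2 + t) * (Real.Gamma (1/2 + t) : ℂ) *
      Complex.Gamma (s + 1/2 + t) = (Complex.Gamma (s + 1/2 + t) * Complex.Gamma (s + 1/2 + t)) *
      (Real.Gamma (1/2 + t) : ℂ) by ring, mul_div_mul_right _ _ gn]
  rw [e, norm_mul]
  have e2 : Real.Gamma (s.re + 1/2 + t) ^ 2 / Real.Gamma (s.re + 1 + 2 * t) =
      (Real.Gamma (s.re + 1/2 + t) * Real.Gamma (1/2 + t) /
      Real.Gamma (s.re + 1/2 + t + (1/2 + t))) *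
      (Real.Gamma (s.re + 1/2 + t) / Real.Gamma (1/2 + t)) := by
    rw [show s.re + 1/2 + t + (1/2 + t : ℝ) = s.re + 1 + 2 * t by ring]
    rw [div_mul_div_comm, sq, show Real.Gamma (s.re + 1/2 + t) * Real.Gamma (1/2 + t) *
      Real.Gamma (s.re + 1/2 + t) = (Real.Gamma (s.re + 1/2 + t) * Real.Gamma (s.re + 1/2 + t)) *
      Real.Gamma (1/2 + t) by ring, mul_div_mul_right _ _ gp.ne']
  rw [e2]
  refine mul_le_mul hb ?_ (norm_nonneg _) ((norm_nonneg _).trans hb)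
  rw [norm_div, Complex.norm_real, Real.norm_of_nonneg gp.le]
  gcongr

lemma ratio_bound {s : ℂ} (hs : 0 < s.re + 3/2) :
    ‖Complex.Gamma (s + 3/2) / Complex.Gamma (s + 2)‖ ≤
      Real.Gamma (s.re + 3/2) / Real.Gamma (s.re + 2) := by
  have r1 : (s + 3/2 : ℂ).re = s.re + 3/2 := by simp
  have r2 : (1/2 : ℂ).re = 1/2 := by simp
  have hb := norm_beta_le (u := s + 3/2) (v := 1/2) (by rw [r1]; exact hs)
    (by rw [r2]; norm_num)
  rw [r1, r2] at hb
  have g2 : Complex.Gamma (1/2) = (Real.Gamma (1/2) : ℂ) := by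
    rw [← Complex.Gamma_ofReal]; push_cast; rfl
  have gp : 0 < Real.Gamma (1/2) := Real.Gamma_pos_of_pos (by norm_num)
  rw [g2, show s + 3/2 + (1/2 : ℂ) = s + 2 by ring, show s.re + 3/2 + (1/2 : ℝ) = s.re + 2 by ring,
    mul_div_right_comm, mul_div_right_comm, norm_mul, Complex.norm_real,
    Real.norm_of_nonneg gp.le] at hb
  exact le_of_mul_le_mul_right hb gp

lemma Gamma_decay {w : ℂ} (hw : 0 < w.re) (n : ℕ) :
    ‖Complex.Gamma w‖ * |w.im| ^ n ≤ Real.Gamma (w.re + n) := by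
  induction n with
  | zero => simpa using norm_Gamma_le_re hw
  | succ n _ =>
    have key : ∀ m : ℕ, ‖Complex.Gamma w‖ * |w.im| ^ m ≤ ‖Complex.Gamma (w + m)‖ := by
      intro m
      induction m with
      | zero => simp
      | succ m ih =>
        have hne : w + m ≠ 0 := by
          intro h
          have := congrArg Complex.re h
          simp at this
          have : (0:ℝ) ≤ m := m.cast_nonneg
          linarith
        have e : Complex.Gamma (w + (m + 1 : ℕ)) = (w + m) * Complex.Gamma (w + m) := by
          rw [← Complex.Gamma_add_one _ hne]; push_cast; congr 1; ring
        rw [e, norm_mul, pow_succ, ← mul_assoc, mul_comm]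
        have : |w.im| ≤ ‖w + m‖ := by simpa using Complex.abs_im_le_norm (w + m)
        gcongr
    refine (key (n + 1)).trans ?_
    have r : (w + (n + 1 : ℕ) : ℂ).re = w.re + (n + 1 : ℕ) := by simp
    have := norm_Gamma_le_re (s := w + (n + 1 : ℕ)) (by rw [r]; positivity)
    rwa [r] at this

lemma cGamma_contOn : ContinuousOn Real.Gamma (Set.Ioi 0) :=
  Real.differentiableOn_Gamma_Ioi.continuousOn

lemma Gamma_lin_contOn {a b : ℝ} (α β : ℝ) (h : ∀ x ∈ Set.Icc a b, 0 < α * x + β) :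
    ContinuousOn (fun x => Real.Gamma (α * x + β)) (Set.Icc a b) :=
  cGamma_contOn.comp (by fun_prop) h

lemma PP_bound {a b : ℝ} (hab : a ≤ b) (ha : -3/2 < a) (hb : b < 1) :
    ∃ C : ℝ, 0 ≤ C ∧ ∀ s : ℂ, a ≤ s.re → s.re ≤ b → ‖PP s‖ ≤ C ∧ ‖PP s‖ * |s.im| ^ 6 ≤ C := by
  have c1 : ContinuousOn (fun x => Real.Gamma (1 * x + 3/2) / Real.Gamma (1 * x + 2)) (Set.Icc a b) :=
    (Gamma_lin_contOn 1 (3/2) (fun x hx => by linarith [hx.1])).div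
      (Gamma_lin_contOn 1 2 (fun x hx => by linarith [hx.1]))
      (fun x hx => (Real.Gamma_pos_of_pos (by linarith [hx.1])).ne')
  have c2 : ContinuousOn (fun x => Real.Gamma (-1 * x + 1)) (Set.Icc a b) :=
    Gamma_lin_contOn (-1) 1 (fun x hx => by linarith [hx.2])
  have c3 : ContinuousOn (fun x => Real.Gamma (-1 * x + 7)) (Set.Icc a b) :=
    Gamma_lin_contOn (-1) 7 (fun x hx => by linarith [hx.2])
  have c4 : ContinuousOn (fun x => Real.exp (3 * x * Real.log 2)) (Set.Icc a b) := by fun_prop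
  obtain ⟨M1, h1⟩ := isCompact_Icc.exists_bound_of_continuousOn ((c1.mul c2).mul c4)
  obtain ⟨M2, h2⟩ := isCompact_Icc.exists_bound_of_continuousOn ((c1.mul c3).mul c4)
  refine ⟨max M1 M2, ?_, ?_⟩
  · exact (norm_nonneg _).trans ((h1 a ⟨le_rfl, hab⟩).trans (le_max_left _ _))
  intro s hs1 hs2
  have b1 := ratio_bound (s := s) (by linarith)
  have ep : ‖cpowR 2 (3 * s)‖ = Real.exp (3 * s.re * Real.log 2) := by
    rw [cpowR, Complex.norm_exp, Complex.re_mul_ofReal]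
    simp
  have b2 := Gamma_decay (w := 1 - s) (by simp; linarith) 0
  have b3 := Gamma_decay (w := 1 - s) (by simp; linarith) 6
  have hr := (norm_nonneg _).trans b1
  have hh1 := (le_abs_self _).trans (h1 s.re ⟨hs1, hs2⟩)
  have hh2 := (le_abs_self _).trans (h2 s.re ⟨hs1, hs2⟩)
  simp only [Complex.sub_re, Complex.one_re, Complex.sub_im, Complex.one_im, zero_sub, abs_neg,
    pow_zero, mul_one] at b2 b3
  rw [show 1 - s.re + ((0 : ℕ) : ℝ) = -1 * s.re + 1 by push_cast; ring] at b2
  rw [show 1 - s.re + ((6 : ℕ) : ℝ) = -1 * s.re + 7 by push_cast; ring] at b3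
  simp only [Pi.mul_apply, one_mul] at hh1 hh2
  constructor
  · refine le_trans ?_ (hh1.trans (le_max_left _ _))
    rw [PP, norm_mul, norm_mul, ep]
    gcongr
  · refine le_trans ?_ (hh2.trans (le_max_right _ _))
    rw [PP, norm_mul, norm_mul, ep]
    calc _ = ‖Complex.Gamma (s + 3/2) / Complex.Gamma (s + 2)‖ *
        (‖Complex.Gamma (1 - s)‖ * |s.im| ^ 6) * Real.exp (3 * s.re * Real.log 2) := by ring
      _ ≤ _ := by gcongr

lemma decay {a b : ℝ} (hab : a ≤ b) (ha : -3/2 < a) (hb : b < 1) (t : ℕ) (ht : 0 < a + 1/2 + t)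
    (α β γ : ℂ) : ∃ C : ℝ, ∀ s : ℂ, a ≤ s.re → s.re ≤ b → 1 ≤ |s.im| →
      ‖PP s * KK t s * ((s + β) * (α * s + γ))‖ ≤ C / s.im ^ 2 := by
  obtain ⟨C, hC0, hC⟩ := PP_bound hab ha hb
  have c1 : ContinuousOn (fun x => Real.Gamma (1 * x + (1/2 + t)) ^ 2 /
      Real.Gamma (1 * x + (1 + 2 * t))) (Set.Icc a b) :=
    ((Gamma_lin_contOn 1 _ (fun x hx => by linarith [hx.1])).pow 2).div
      (Gamma_lin_contOn 1 _ (fun x hx => by linarith [hx.1, t.cast_nonneg (α := ℝ)]))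
      (fun x hx => (Real.Gamma_pos_of_pos (by linarith [hx.1, t.cast_nonneg (α := ℝ)])).ne')
  obtain ⟨M, hM⟩ := isCompact_Icc.exists_bound_of_continuousOn c1
  have hM0 : 0 ≤ M := (norm_nonneg _).trans (hM a ⟨le_rfl, hab⟩)
  set R := |a| + |b| + 1 with hR
  have hR0 : 0 ≤ R := by positivity
  refine ⟨C * M * ((R + ‖β‖) * (‖α‖ * R + ‖γ‖)), ?_⟩
  intro s h1 h2 h3
  have y0 : 0 < |s.im| := by linarith
  have k1 : ‖KK t s‖ ≤ M := by
    refine (KK_bound (by linarith)).trans ?_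
    have := (le_abs_self _).trans (hM s.re ⟨h1, h2⟩)
    simpa only [one_mul, add_assoc] using this
  have k2 : ‖PP s‖ ≤ C / |s.im| ^ 6 := by
    rw [le_div_iff₀ (by positivity)]; exact (hC s h1 h2).2
  have hs : ‖s‖ ≤ R * |s.im| := by
    have : ‖s‖ ≤ |s.re| + |s.im| := Complex.norm_le_abs_re_add_abs_im s
    have : |s.re| ≤ |a| + |b| := by
      rw [abs_le]
      constructor
      · linarith [neg_abs_le a, abs_nonneg b]
      · linarith [le_abs_self b, abs_nonneg a]
    have : 0 ≤ |a| + |b| := by positivity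
    rw [hR]
    nlinarith
  have k3 : ‖s + β‖ ≤ (R + ‖β‖) * |s.im| := by
    refine (norm_add_le _ _).trans ?_
    nlinarith [norm_nonneg β]
  have k4 : ‖α * s + γ‖ ≤ (‖α‖ * R + ‖γ‖) * |s.im| := by
    refine (norm_add_le _ _).trans ?_
    rw [norm_mul]
    nlinarith [norm_nonneg γ, norm_nonneg α, mul_le_mul_of_nonneg_left hs (norm_nonneg α)]
  rw [norm_mul, norm_mul, norm_mul]
  calc _ ≤ (C / |s.im| ^ 6) * M * (((R + ‖β‖) * |s.im|) * ((‖α‖ * R + ‖γ‖) * |s.im|)) := by gcongr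
    _ = C * M * ((R + ‖β‖) * (‖α‖ * R + ‖γ‖)) / |s.im| ^ 4 := by
      field_simp
    _ ≤ _ := by
      rw [← sq_abs s.im]
      gcongr
      · norm_num

lemma diff_Gamma {s : ℂ} (hs : 0 < s.re) : DifferentiableAt ℂ Complex.Gamma s := by
  refine Complex.differentiableAt_Gamma s fun m h => ?_
  have := congrArg Complex.re h
  simp at this
  linarith [m.cast_nonneg (α := ℝ)]

lemma diff_PP {s : ℂ} (h1 : -3/2 < s.re) (h2 : s.re < 1) : DifferentiableAt ℂ PP s := by
  have d1 : DifferentiableAt ℂ (fun s => Complex.Gamma (s + 3/2)) s :=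
    (diff_Gamma (by simp; linarith)).comp s (f := fun s : ℂ => s + 3/2) (by fun_prop)
  have d2 : DifferentiableAt ℂ (fun s => Complex.Gamma (s + 2)) s :=
    (diff_Gamma (by simp; linarith)).comp s (f := fun s : ℂ => s + 2) (by fun_prop)
  have d3 : DifferentiableAt ℂ (fun s => Complex.Gamma (1 - s)) s :=
    (diff_Gamma (by simp; linarith)).comp s (f := fun s : ℂ => 1 - s) (by fun_prop)
  have d4 : DifferentiableAt ℂ (fun s => cpowR 2 (3 * s)) s := by unfold cpowR; fun_prop
  exact ((d1.div d2 (Complex.Gamma_ne_zero_of_re_pos (by simp; linarith))).mul d3).mul d4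

lemma diff_KK {t : ℕ} {s : ℂ} (h : 0 < s.re + 1/2 + t) : DifferentiableAt ℂ (KK t) s := by
  have d1 : DifferentiableAt ℂ (fun s => Complex.Gamma (s + 1/2 + t)) s :=
    (diff_Gamma (by simpa using h)).comp s (f := fun s : ℂ => s + 1/2 + t) (by fun_prop)
  have p : 0 < (s + 1 + 2 * t : ℂ).re := by
    simp; linarith [t.cast_nonneg (α := ℝ)]
  have d2 : DifferentiableAt ℂ (fun s => Complex.Gamma (s + 1 + 2 * t)) s :=
    (diff_Gamma p).comp s (f := fun s : ℂ => s + 1 + 2 * t) (by fun_prop)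
  exact (d1.pow 2).div d2 (Complex.Gamma_ne_zero_of_re_pos p)

/-- `gg t s / (s + 1/2)` is the normalized integrand. -/
noncomputable def gg (t : ℕ) (s : ℂ) : ℂ :=
  4 ^ t * (PP s * KK t s * ((s + 1) * (3 * s + (2 * t + 1)))) / (-s)

/-- The WZ mate. -/
noncomputable def WW (t : ℕ) (s : ℂ) : ℂ :=
  4 ^ t * (PP s * KK t s * ((s + 1) * (1 * s + 0))) / ((s + 1/2) * (s + (2 * t + 1)))

lemma ne_of_re {s : ℂ} (r : ℝ) (h : s.re + r ≠ 0) : s + r ≠ 0 := by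
  intro h'
  have := congrArg Complex.re h'
  simp at this
  exact h this

lemma im_le_norm_add (s : ℂ) (r : ℝ) : |s.im| ≤ ‖s + r‖ := by
  simpa using Complex.abs_im_le_norm (s + r)

lemma diff_gg {t : ℕ} {s : ℂ} (h1 : -3/2 < s.re) (h2 : s.re < 0) (h : 0 < s.re + 1/2 + t) :
    DifferentiableAt ℂ (gg t) s := by
  have d1 := diff_PP h1 (by linarith)
  have d2 := diff_KK h
  have : -s ≠ 0 := by rintro h; rw [neg_eq_zero.mp h] at h2; simp at h2
  exact (((d1.mul d2).mul (by fun_prop)).const_mul _).div (by fun_prop) this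

lemma diff_WW {t : ℕ} {s : ℂ} (h1 : -1/2 < s.re) (h2 : s.re < 1) :
    DifferentiableAt ℂ (WW t) s := by
  have tn := t.cast_nonneg (α := ℝ)
  have d1 := diff_PP (s := s) (by linarith) h2
  have d2 := diff_KK (t := t) (s := s) (by linarith)
  have n1 := ne_of_re (s := s) (1/2) (by linarith)
  have n2 := ne_of_re (s := s) (2 * t + 1) (by linarith)
  push_cast at n1 n2
  exact (((d1.mul d2).mul (by fun_prop)).const_mul _).div (by fun_prop) (mul_ne_zero n1 n2)

lemma decay_gg {a b : ℝ} (hab : a ≤ b) (ha : -3/2 < a) (hb : b < 1) (t : ℕ)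
    (ht : 0 < a + 1/2 + t) : ∃ C : ℝ, ∀ s : ℂ, a ≤ s.re → s.re ≤ b → 1 ≤ |s.im| →
      ‖gg t s‖ ≤ C / s.im ^ 2 := by
  obtain ⟨C, hC⟩ := decay hab ha hb t ht 3 1 (2 * t + 1)
  refine ⟨4 ^ t * C, fun s h1 h2 h3 => ?_⟩
  rw [gg, norm_div, norm_mul, norm_pow, norm_neg]
  have : 1 ≤ ‖s‖ := h3.trans (Complex.abs_im_le_norm s)
  refine (div_le_self (by positivity) this).trans ?_
  have := hC s h1 h2 h3
  rw [show ‖(4:ℂ)‖ = 4 by simp, mul_div_assoc]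
  gcongr

lemma decay_WW {a b : ℝ} (hab : a ≤ b) (ha : -3/2 < a) (hb : b < 1) (t : ℕ)
    (ht : 0 < a + 1/2 + t) : ∃ C : ℝ, ∀ s : ℂ, a ≤ s.re → s.re ≤ b → 1 ≤ |s.im| →
      ‖WW t s‖ ≤ C / s.im ^ 2 := by
  obtain ⟨C, hC⟩ := decay hab ha hb t ht 1 1 0
  refine ⟨4 ^ t * C, fun s h1 h2 h3 => ?_⟩
  rw [WW, norm_div, norm_mul, norm_mul (s + 1/2), norm_pow]
  have b1 : 1 ≤ ‖s + 1/2‖ := h3.trans (by simpa using im_le_norm_add s (1/2))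
  have b2 : 1 ≤ ‖s + (2 * t + 1)‖ := h3.trans (by simpa using im_le_norm_add s (2 * t + 1))
  refine (div_le_self (by positivity) (by nlinarith)).trans ?_
  have := hC s h1 h2 h3
  rw [show ‖(4:ℂ)‖ = 4 by simp, mul_div_assoc]
  gcongr

lemma wz {t : ℕ} {s : ℂ} (h1 : -1/2 < s.re) (h2 : s.re < 0) :
    gg (t + 1) s / (s + 1/2) - gg t s / (s + 1/2) = WW t (s + 1) - WW t s := by
  have tn := t.cast_nonneg (α := ℝ)
  have n0 := ne_of_re (s := s) 0 (by linarith)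
  have n1 := ne_of_re (s := s) (1/2) (by linarith)
  have n2 := ne_of_re (s := s) (2 * t + 1) (by linarith)
  have n3 := ne_of_re (s := s) (2 * t + 2) (by linarith)
  have n4 := ne_of_re (s := s) (3/2) (by linarith)
  have n5 := ne_of_re (s := s) 2 (by linarith)
  have n6 := ne_of_re (s := s) (1/2 + t) (by linarith)
  push_cast at n0 n1 n2 n3 n4 n5 n6
  rw [add_zero] at n0
  have p : 0 < (s + 1 + 2 * t : ℂ).re := by simp; linarith
  have gne : Complex.Gamma (s + 1 + 2 * t) ≠ 0 := Complex.Gamma_ne_zero_of_re_pos p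
  have g2ne : Complex.Gamma (s + 2) ≠ 0 := Complex.Gamma_ne_zero_of_re_pos (by simp; linarith)
  have e1 : Complex.Gamma (s + 1/2 + (t + 1)) = (s + (1/2 + t)) * Complex.Gamma (s + 1/2 + t) := by
    rw [show s + 1/2 + (t + 1 : ℂ) = s + (1/2 + t) + 1 by ring, Complex.Gamma_add_one _ n6]
    congr 2; ring
  have e1' : Complex.Gamma (s + 1 + 1/2 + t) = (s + (1/2 + t)) * Complex.Gamma (s + 1/2 + t) := by
    rw [← e1]; congr 1; ring
  have e2 : Complex.Gamma (s + 1 + 1 + 2 * t) = (s + (2 * t + 1)) * Complex.Gamma (s + 1 + 2 * t) := by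
    rw [show s + 1 + 1 + 2 * (t : ℂ) = s + (2 * t + 1) + 1 by ring, Complex.Gamma_add_one _ n2]
    congr 2; ring
  have e3 : Complex.Gamma (s + 1 + 2 * (t + 1)) =
      (s + (2 * t + 2)) * ((s + (2 * t + 1)) * Complex.Gamma (s + 1 + 2 * t)) := by
    rw [← e2, show s + 1 + 2 * (t + 1 : ℂ) = s + (2 * t + 2) + 1 by ring,
      Complex.Gamma_add_one _ n3]
    congr 2; ring
  have k1 : KK (t + 1) s = KK t s * ((s + (1/2 + t)) ^ 2 / ((s + (2 * t + 2)) * (s + (2 * t + 1)))) := by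
    rw [KK, KK]
    push_cast
    rw [e1, e3]
    field_simp
  have k2 : KK t (s + 1) = KK t s * ((s + (1/2 + t)) ^ 2 / (s + (2 * t + 1))) := by
    rw [KK, KK, e1', e2]
    field_simp
  have f1 : Complex.Gamma (s + 1 + 3/2) = (s + 3/2) * Complex.Gamma (s + 3/2) := by
    rw [← Complex.Gamma_add_one _ n4]; congr 1; ring
  have f2 : Complex.Gamma (s + 1 + 2) = (s + 2) * Complex.Gamma (s + 2) := by
    rw [← Complex.Gamma_add_one _ n5]; congr 1; ring
  have f3 : Complex.Gamma (1 - s) = -s * Complex.Gamma (1 - (s + 1)) := by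
    rw [show 1 - s = -s + 1 by ring, Complex.Gamma_add_one _ (neg_ne_zero.mpr n0)]
    congr 2; ring
  have f4 : cpowR 2 (3 * (s + 1)) = cpowR 2 (3 * s) * 8 := by
    have : (8 : ℂ) = Complex.exp (3 * (Real.log 2 : ℂ)) := by
      rw [show (3 : ℂ) * (Real.log 2 : ℂ) = ((3 * Real.log 2 : ℝ) : ℂ) by push_cast; rfl,
        ← Complex.ofReal_exp, mul_comm, Real.exp_mul, Real.exp_log (by norm_num)]
      norm_num
    rw [cpowR, cpowR, this, ← Complex.exp_add]
    congr 1; ring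
  have q : PP (s + 1) = PP s * ((s + 3/2) * 8 / ((s + 2) * (-s))) := by
    rw [PP, PP, f1, f2, f4, f3]
    field_simp
  have m1 : s + 1 + 1/2 ≠ 0 := by rw [show s + 1 + 1/2 = s + 3/2 by ring]; exact n4
  have m2 : s + 1 + (2 * t + 1 : ℂ) ≠ 0 := by
    rw [show s + 1 + (2 * t + 1 : ℂ) = s + (2 * t + 2) by ring]; exact n3
  rw [gg, gg, WW, WW, k1, k2, q, show s + 1 + 1/2 = s + 3/2 by ring,
    show s + 1 + (2 * t + 1 : ℂ) = s + (2 * t + 2) by ring]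
  generalize PP s = P
  generalize KK t s = K
  push_cast
  generalize (t : ℂ) = τ at *
  have L : 4 ^ (t + 1) * (P * (K * ((s + (1/2 + τ)) ^ 2 / ((s + (2 * τ + 2)) * (s + (2 * τ + 1))))) *
        ((s + 1) * (3 * s + (2 * (τ + 1) + 1)))) / (-s) / (s + 1/2) -
      4 ^ t * (P * K * ((s + 1) * (3 * s + (2 * τ + 1)))) / (-s) / (s + 1/2) =
      (4 ^ t * P * K * (s + 1)) * ((3 * s + (2 * τ + 1)) * (s + (2 * τ + 2)) * (s + (2 * τ + 1))
        - 4 * (s + (1/2 + τ)) ^ 2 * (3 * s + (2 * (τ + 1) + 1))) /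
        (s * (s + 1/2) * ((s + (2 * τ + 2)) * (s + (2 * τ + 1)))) := by
    rw [pow_succ]
    generalize s + (1/2 + τ) = A
    generalize s + (2 * τ + 2) = B at *
    generalize s + (2 * τ + 1) = D at *
    generalize s + 1/2 = E at *
    field_simp
    ring
  have Rr : 4 ^ t * (P * ((s + 3/2) * 8 / ((s + 2) * -s)) * (K * ((s + (1/2 + τ)) ^ 2 / (s + (2 * τ + 1)))) *
        ((s + 1 + 1) * (1 * (s + 1) + 0))) / ((s + 3/2) * (s + (2 * τ + 2))) -
      4 ^ t * (P * K * ((s + 1) * (1 * s + 0))) / ((s + 1/2) * (s + (2 * τ + 1))) =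
      (4 ^ t * P * K * (s + 1)) * (-(8 * (s + (1/2 + τ)) ^ 2 * (s + 1/2))
        - s ^ 2 * (s + (2 * τ + 2))) /
        (s * (s + 1/2) * ((s + (2 * τ + 2)) * (s + (2 * τ + 1)))) := by
    rw [show s + 1 + 1 = s + 2 by ring]
    generalize s + (1/2 + τ) = A
    generalize s + (2 * τ + 2) = B at *
    generalize s + (2 * τ + 1) = D at *
    generalize s + 1/2 = E at *
    generalize s + 3/2 = F at *
    generalize s + 2 = H at *
    field_simp
    ring
  rw [L, Rr]
  congr 2
  ring

lemma int_gg {t : ℕ} {c : ℝ} (h1 : -1/2 < c) (h2 : c < 0) :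
    Integrable (fun y : ℝ => gg t ((c : ℂ) + (y : ℂ) * Complex.I) /
      ((c : ℂ) + (y : ℂ) * Complex.I + 1/2)) := by
  have tn := t.cast_nonneg (α := ℝ)
  obtain ⟨C, hC⟩ := decay_gg (a := c) (b := c) le_rfl (by linarith) (by linarith) t (by linarith)
  refine line_integrable (f := fun s => gg t s / (s + 1/2)) (c := c) ?_ C ?_
  · intro s hs
    have n1 := ne_of_re (s := s) (1/2) (by linarith)
    push_cast at n1
    exact (diff_gg (by linarith) (by linarith) (by linarith)).div (by fun_prop) n1
  · intro s hs h3
    have b1 : 1 ≤ ‖s + 1/2‖ := h3.trans (by simpa using im_le_norm_add s (1/2))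
    rw [norm_div]
    exact (div_le_self (norm_nonneg _) b1).trans (hC s hs.ge hs.le h3)

/-- The normalized integral. -/
noncomputable def JJ (c : ℝ) (t : ℕ) : ℂ :=
  ∫ y : ℝ, gg t ((c : ℂ) + (y : ℂ) * Complex.I) / ((c : ℂ) + (y : ℂ) * Complex.I + 1/2)

lemma JJ_succ {t : ℕ} {c : ℝ} (h1 : -1/2 < c) (h2 : c < 0) : JJ c (t + 1) = JJ c t := by
  have tn := t.cast_nonneg (α := ℝ)
  obtain ⟨C, hC⟩ := decay_WW (a := c) (b := c + 1) (by linarith) (by linarith) (by linarith) t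
    (by linarith)
  have hd : ∀ s : ℂ, c ≤ s.re → s.re ≤ c + 1 → DifferentiableAt ℂ (WW t) s :=
    fun s a b => diff_WW (by linarith) (by linarith)
  have sh := shift_line (by linarith) hd C hC
  have i1 := line_integrable (f := WW t) (c := c)
    (fun s h => hd s h.ge (by linarith)) C (fun s h => hC s h.ge (by linarith))
  have i2 := line_integrable (f := WW t) (c := c + 1)
    (fun s h => hd s (by linarith) h.le) C (fun s h => hC s (by linarith) h.le)
  rw [← sub_eq_zero, JJ, JJ, ← integral_sub (int_gg h1 h2) (int_gg h1 h2)]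
  have : ∀ y : ℝ, gg (t + 1) ((c : ℂ) + (y : ℂ) * Complex.I) /
      ((c : ℂ) + (y : ℂ) * Complex.I + 1/2) - gg t ((c : ℂ) + (y : ℂ) * Complex.I) /
      ((c : ℂ) + (y : ℂ) * Complex.I + 1/2) =
      WW t (((c + 1 : ℝ) : ℂ) + (y : ℂ) * Complex.I) - WW t ((c : ℂ) + (y : ℂ) * Complex.I) := by
    intro y
    rw [wz (by simpa using h1) (by simpa using h2)]
    congr 2
    push_cast; ring
  simp_rw [this]
  rw [integral_sub i2 i1, sh, sub_self]

lemma JJ_const {c : ℝ} (h1 : -1/2 < c) (h2 : c < 0) (t : ℕ) : JJ c t = JJ c 0 := by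
  induction t with
  | zero => rfl
  | succ t ih => rw [JJ_succ h1 h2, ih]

lemma JJ_residue {c : ℝ} (h1 : -1/2 < c) (h2 : c < 0) (n : ℕ) :
    JJ c (n + 1) = JJ (-1) (n + 1) + 2 * π * gg (n + 1) (-1/2) := by
  have tn := n.cast_nonneg (α := ℝ)
  obtain ⟨C, hC⟩ := decay_gg (a := -1) (b := c) (by linarith) (by norm_num) (by linarith) (n + 1)
    (by push_cast; linarith)
  exact residue_shift (by norm_num) (by norm_num) h1
    (fun s a b => diff_gg (by linarith) (by linarith) (by push_cast; linarith)) C hC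

lemma Gamma_asymp {x : ℝ} (hx : -1 < x) (hx0 : x ≠ 0) :
    Tendsto (fun n : ℕ => Real.Gamma (n + 1 + x) / ((n : ℝ) ^ x * Real.Gamma (n + 1)))
      atTop (𝓝 1) := by
  have hne : ∀ m : ℕ, x + m ≠ 0 := by
    intro m
    rcases m with _ | m
    · simpa using hx0
    · have := m.cast_nonneg (α := ℝ)
      push_cast
      intro h
      linarith
  have hG : Real.Gamma x ≠ 0 := Real.Gamma_ne_zero fun m h => hne m (by rw [h]; ring)
  have prod : ∀ n : ℕ, Real.Gamma (x + n) = (∏ j ∈ Finset.range n, (x + j)) * Real.Gamma x := by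
    intro n
    induction n with
    | zero => simp
    | succ n ih =>
      rw [Finset.prod_range_succ]
      push_cast
      rw [← add_assoc, Real.Gamma_add_one (hne n), ih]
      ring
  have h := (tendsto_const_nhds (x := Real.Gamma x)).div (Real.GammaSeq_tendsto_Gamma x) hG
  rw [div_self hG] at h
  refine h.congr fun n => ?_
  simp only [Pi.div_apply, Real.GammaSeq]
  rw [Real.Gamma_nat_eq_factorial, show (n : ℝ) + 1 + x = x + (n + 1 : ℕ) by push_cast; ring,
    prod (n + 1), div_div_eq_mul_div, mul_comm]

lemma res_value (n : ℕ) : gg (n + 1) (-1/2) =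
    ((√π * (Real.Gamma (n + 1) ^ 2 / (Real.Gamma (n + 1 + -(1/4)) * Real.Gamma (n + 1 + 1/4))) : ℝ) : ℂ) := by
  have tn := n.cast_nonneg (α := ℝ)
  have g32 : Complex.Gamma (3/2) ≠ 0 := Complex.Gamma_ne_zero_of_re_pos (by simp)
  have p : PP (-1/2) = (((2:ℝ) ^ (-3/2 : ℝ) : ℝ) : ℂ) := by
    rw [PP, show (-1/2 : ℂ) + 3/2 = 1 by norm_num, show (-1/2 : ℂ) + 2 = 3/2 by norm_num,
      show (1 : ℂ) - -1/2 = 3/2 by norm_num, Complex.Gamma_one, one_div, inv_mul_cancel₀ g32,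
      one_mul, cpowR, Real.rpow_def_of_pos (by norm_num), Complex.ofReal_exp]
    congr 1
    push_cast
    ring
  have k : KK (n + 1) (-1/2) = ((Real.Gamma (n + 1) ^ 2 /
      ((2 * n + 3/2) * Real.Gamma (2 * n + 3/2)) : ℝ) : ℂ) := by
    rw [KK, ← Real.Gamma_add_one (by linarith)]
    rw [show (-1/2:ℂ) + 1/2 + ((n + 1 : ℕ) : ℂ) = (((n:ℝ) + 1 : ℝ) : ℂ) by push_cast; ring,
      show (-1/2:ℂ) + 1 + 2 * ((n + 1 : ℕ) : ℂ) = ((2 * (n:ℝ) + 3/2 + 1 : ℝ) : ℂ) by push_cast; ring,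
      Complex.Gamma_ofReal, Complex.Gamma_ofReal]
    push_cast
    rfl
  have leg := Real.Gamma_mul_Gamma_add_half ((n : ℝ) + 1 + -(1/4))
  rw [show (n : ℝ) + 1 + -(1/4) + 1/2 = n + 1 + 1/4 by ring,
    show 2 * ((n : ℝ) + 1 + -(1/4)) = 2 * n + 3/2 by ring] at leg
  rw [gg, p, k, leg]
  have hpow : (4:ℝ) ^ (n + 1) * (2:ℝ) ^ (-3/2 : ℝ) * (2:ℝ) ^ (1 - (2 * (n:ℝ) + 3/2)) = 1 := by
    have : (4:ℝ) ^ (n + 1) = (2:ℝ) ^ (2 * (n:ℝ) + 2) := by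
      rw [show (2 * (n:ℝ) + 2) = ((2 * (n + 1) : ℕ) : ℝ) by push_cast; ring, Real.rpow_natCast,
        pow_mul]
      norm_num
    rw [this, ← Real.rpow_add (by norm_num), ← Real.rpow_add (by norm_num)]
    ring_nf
    simp
  have g1 : Real.Gamma (2 * n + 3/2) ≠ 0 := (Real.Gamma_pos_of_pos (by linarith)).ne'
  have g2 : (2:ℝ) ^ (1 - (2 * (n:ℝ) + 3/2)) ≠ 0 := by positivity
  have g3 : √π ≠ 0 := by positivity
  have g4 : 2 * (n:ℝ) + 3/2 ≠ 0 := by positivity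
  have R : (4:ℝ) ^ (n + 1) * ((2:ℝ) ^ (-3/2 : ℝ) * (Real.Gamma (n + 1) ^ 2 /
      ((2 * n + 3/2) * Real.Gamma (2 * n + 3/2))) * ((1/2) * (2 * n + 3/2))) / (1/2) =
      √π * (Real.Gamma (n + 1) ^ 2 / (Real.Gamma (2 * n + 3/2) *
        (2:ℝ) ^ (1 - (2 * (n:ℝ) + 3/2)) * √π)) := by
    generalize Real.Gamma (2 * n + 3/2) = A at *
    generalize (2:ℝ) ^ (1 - (2 * (n:ℝ) + 3/2)) = B at *
    generalize (2:ℝ) ^ (-3/2 : ℝ) = D at *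
    generalize (2 * (n:ℝ) + 3/2) = E at *
    have hD : (4:ℝ) ^ (n + 1) * D = 1 / B := eq_div_of_mul_eq g2 hpow
    calc _ = ((4:ℝ) ^ (n + 1) * D) * (Real.Gamma (n + 1) ^ 2 / A) := by field_simp
      _ = _ := by rw [hD]; field_simp
  rw [← R]
  rw [show (-1/2 : ℂ) + 1 = 1/2 by norm_num,
    show 3 * (-1/2 : ℂ) + (2 * ((n + 1 : ℕ) : ℂ) + 1) = 2 * n + 3/2 by push_cast; ring,
    show -(-1/2 : ℂ) = 1/2 by norm_num]
  push_cast
  ring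

lemma res_tendsto : Tendsto (fun n : ℕ => gg (n + 1) (-1/2)) atTop (𝓝 ((√π : ℝ) : ℂ)) := by
  simp_rw [res_value]
  refine (Complex.continuous_ofReal.tendsto _).comp ?_
  have h := ((Gamma_asymp (x := -(1/4)) (by norm_num) (by norm_num)).mul
    (Gamma_asymp (x := 1/4) (by norm_num) (by norm_num))).inv₀ (by norm_num)
  have h2 := h.const_mul √π
  simp only [mul_one, inv_one] at h2
  refine h2.congr' ?_
  filter_upwards [eventually_gt_atTop 0] with n hn
  have hn : (0:ℝ) < n := by exact_mod_cast hn
  congr 1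
  rw [div_mul_div_comm, inv_div]
  congr 1
  have : (n:ℝ) ^ (-(1/4) : ℝ) * (n:ℝ) ^ ((1/4) : ℝ) = 1 := by
    rw [← Real.rpow_add hn]; norm_num
  linear_combination (Real.Gamma (n + 1) ^ 2) * this

lemma eps_tendsto : Tendsto (fun n : ℕ => (4:ℝ) ^ (n + 1) * (Real.Gamma (n + 1/2) ^ 2 /
    Real.Gamma (2 * n + 2)) * (2 * n + 2)) atTop (𝓝 0) := by
  have h0 : Tendsto (fun n : ℕ => Real.Gamma (n + 1/2) / Real.Gamma (n + 1)) atTop (𝓝 0) := by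
    have h := Gamma_asymp (x := -(1/2)) (by norm_num) (by norm_num)
    have h' : Tendsto (fun n : ℕ => (n:ℝ) ^ (-(1/2) : ℝ)) atTop (𝓝 0) :=
      (tendsto_rpow_neg_atTop (by norm_num)).comp tendsto_natCast_atTop_atTop
    have h2 := h.mul h'
    simp only [one_mul] at h2
    refine h2.congr' ?_
    filter_upwards [eventually_gt_atTop 0] with n hn
    have hn : (0:ℝ) < n := by exact_mod_cast hn
    have g : (n:ℝ) ^ (-(1/2) : ℝ) ≠ 0 := by positivity
    rw [show (n:ℝ) + 1 + -(1/2) = n + 1/2 by ring]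
    rw [div_mul_eq_mul_div, mul_comm ((n:ℝ) ^ (-(1/2) : ℝ)) (Real.Gamma (n + 1)),
      mul_div_mul_right _ _ g]
  have h1 := h0.const_mul (8 * √π)
  rw [mul_zero] at h1
  refine squeeze_zero (fun n => by
    have := Real.Gamma_pos_of_pos (s := 2 * n + 2) (by positivity)
    positivity) ?_ h1
  intro n
  have tn := n.cast_nonneg (α := ℝ)
  have leg := Real.Gamma_mul_Gamma_add_half ((n : ℝ) + 1)
  rw [show (n : ℝ) + 1 + 1/2 = (n + 1/2) + 1 by ring, Real.Gamma_add_one (s := (n : ℝ) + 1/2) (by positivity),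
    show 2 * ((n : ℝ) + 1) = 2 * n + 2 by ring] at leg
  have hpow : (4:ℝ) ^ (n + 1) * (2:ℝ) ^ (1 - (2 * (n:ℝ) + 2)) = 2 := by
    have : (4:ℝ) ^ (n + 1) = (2:ℝ) ^ (2 * (n:ℝ) + 2) := by
      rw [show (2 * (n:ℝ) + 2) = ((2 * (n + 1) : ℕ) : ℝ) by push_cast; ring, Real.rpow_natCast,
        pow_mul]
      norm_num
    rw [this, ← Real.rpow_add (by norm_num)]
    norm_num
  have g1 := Real.Gamma_pos_of_pos (s := 2 * n + 2) (by positivity)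
  have g2 := Real.Gamma_pos_of_pos (s := n + 1) (by positivity)
  have g3 := Real.Gamma_pos_of_pos (s := n + 1/2) (by positivity)
  have g4 : 0 < √π := by positivity
  have g5 : (0:ℝ) < (2:ℝ) ^ (1 - (2 * (n:ℝ) + 2)) := by positivity
  generalize Real.Gamma (2 * n + 2) = A at *
  generalize Real.Gamma (n + 1) = B at *
  generalize Real.Gamma (n + 1/2) = D at *
  generalize (2:ℝ) ^ (1 - (2 * (n:ℝ) + 2)) = E at *
  generalize (4:ℝ) ^ (n + 1) = F at *
  generalize √π = S at *
  have hA : F * B * ((n + 1/2) * D) = 2 * (A * S) := by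
    rw [mul_assoc, leg]; linear_combination A * S * hpow
  rw [← mul_div_assoc, ← mul_div_assoc, div_mul_eq_mul_div, div_le_div_iff₀ g1 g2]
  have e : F * D ^ 2 * (2 * n + 2) * B * (n + 1/2) = 2 * (A * S) * D * (2 * n + 2) := by
    linear_combination D * (2 * n + 2) * hA
  have hp : (0:ℝ) < n + 1/2 := by positivity
  refine le_of_mul_le_mul_right ?_ hp
  rw [e]
  have : 0 ≤ A * S * D := by positivity
  nlinarith

lemma JJ_neg_one_tendsto : Tendsto (fun n : ℕ => JJ (-1) (n + 1)) atTop (𝓝 0) := by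
  obtain ⟨C, hC0, hC⟩ := PP_bound (a := -1) (b := -1) le_rfl (by norm_num) (by norm_num)
  have h1 := eps_tendsto.mul_const (16 * C * π)
  rw [zero_mul] at h1
  refine squeeze_zero_norm (fun n => ?_) h1
  have tn := n.cast_nonneg (α := ℝ)
  set ε : ℝ := (4:ℝ) ^ (n + 1) * (Real.Gamma (n + 1/2) ^ 2 / Real.Gamma (2 * n + 2)) * (2 * n + 2)
    with hε
  have gp := Real.Gamma_pos_of_pos (s := 2 * n + 2) (by positivity)
  have gp2 := Real.Gamma_pos_of_pos (s := n + 1/2) (by positivity)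
  have hε0 : 0 ≤ ε := by positivity
  have hbound : ∀ y : ℝ, ‖gg (n + 1) (((-1 : ℝ) : ℂ) + (y : ℂ) * Complex.I) /
      (((-1 : ℝ) : ℂ) + (y : ℂ) * Complex.I + 1/2)‖ ≤ ε * (16 * C) * (1 + y ^ 2)⁻¹ := by
    intro y
    set s : ℂ := ((-1 : ℝ) : ℂ) + (y : ℂ) * Complex.I with hs
    have sre : s.re = -1 := by simp [hs]
    have sim : s.im = y := by simp [hs]
    have k := KK_bound (t := n + 1) (s := s) (by rw [sre]; push_cast; linarith)
    rw [sre] at k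
    push_cast at k
    rw [show (-1 : ℝ) + 1/2 + (n + 1) = n + 1/2 by ring,
      show (-1 : ℝ) + 1 + 2 * (n + 1) = 2 * n + 2 by ring] at k
    obtain ⟨p1, p2⟩ := hC s sre.ge sre.le
    rw [sim] at p2
    have a1 : ‖s + 1‖ ≤ |y| := by
      rw [show s + 1 = (y : ℂ) * Complex.I by rw [hs]; push_cast; ring]
      simp
    have a2 : ‖3 * s + (2 * ((n + 1 : ℕ) : ℂ) + 1)‖ ≤ (2 * n + 2) * (3 * |y| + 1) := by
      rw [show 3 * s + (2 * ((n + 1 : ℕ) : ℂ) + 1) = 3 * ((y : ℂ) * Complex.I) + ((2 * n : ℝ) : ℂ) by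
        rw [hs]; push_cast; ring]
      refine (norm_add_le _ _).trans ?_
      rw [Complex.norm_real, Real.norm_of_nonneg (by positivity)]
      simp only [norm_mul, Complex.norm_real, Complex.norm_I, mul_one, Complex.norm_ofNat,
        Real.norm_eq_abs]
      nlinarith [abs_nonneg y, mul_nonneg tn (abs_nonneg y)]
    have a3 : 1 ≤ ‖s‖ := by
      have := Complex.abs_re_le_norm s
      rw [sre] at this; simpa using this
    have a4 : 1/2 ≤ ‖s + 1/2‖ := by
      have := Complex.abs_re_le_norm (s + 1/2)
      have e : (s + 1/2).re = -1/2 := by simp [sre]; norm_num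
      rw [e] at this
      refine le_trans ?_ this
      rw [abs_of_neg] <;> norm_num
    have a5 : ‖PP s‖ * (|y| * (3 * |y| + 1)) ≤ 8 * C * (1 + y ^ 2)⁻¹ := by
      rw [← div_eq_mul_inv, le_div_iff₀ (by positivity), ← sq_abs y]
      have hy := abs_nonneg y
      generalize |y| = r at *
      have hP := norm_nonneg (PP s)
      rcases le_total r 1 with hr | hr
      · have : r * (3 * r + 1) * (1 + r ^ 2) ≤ 8 := by
          have : r * (3 * r + 1) ≤ 4 := by nlinarith
          have : 1 + r ^ 2 ≤ 2 := by nlinarith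
          have : 0 ≤ r * (3 * r + 1) := by positivity
          nlinarith
        calc _ = ‖PP s‖ * (r * (3 * r + 1) * (1 + r ^ 2)) := by ring
          _ ≤ C * 8 := by gcongr
          _ = _ := by ring
      · have : r * (3 * r + 1) * (1 + r ^ 2) ≤ 8 * r ^ 6 := by
          have h1 : r * (3 * r + 1) ≤ 4 * r ^ 2 := by nlinarith
          have h2 : 1 + r ^ 2 ≤ 2 * r ^ 2 := by nlinarith
          calc _ ≤ (4 * r ^ 2) * (2 * r ^ 2) := by gcongr
            _ = 8 * r ^ 4 := by ring
            _ ≤ 8 * r ^ 6 := by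
              gcongr
              · norm_num
        calc _ = ‖PP s‖ * (r * (3 * r + 1) * (1 + r ^ 2)) := by ring
          _ ≤ ‖PP s‖ * (8 * r ^ 6) := by gcongr
          _ = 8 * (‖PP s‖ * r ^ 6) := by ring
          _ ≤ _ := by gcongr
    rw [gg, norm_div, norm_div, norm_neg, norm_mul, norm_pow, norm_mul, norm_mul, norm_mul,
      show ‖(4:ℂ)‖ = 4 by simp]
    calc _ ≤ (4:ℝ) ^ (n + 1) * (‖PP s‖ * (Real.Gamma (n + 1/2) ^ 2 / Real.Gamma (2 * n + 2)) *
          (|y| * ((2 * n + 2) * (3 * |y| + 1)))) / 1 / (1/2) := by gcongr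
      _ = ε * 2 * (‖PP s‖ * (|y| * (3 * |y| + 1))) := by rw [hε]; ring
      _ ≤ ε * 2 * (8 * C * (1 + y ^ 2)⁻¹) := by gcongr
      _ = _ := by ring
  have := norm_integral_le_of_norm_le
    (integrable_inv_one_add_sq.const_mul (ε * (16 * C))) (ae_of_all _ hbound)
  rw [integral_const_mul, integral_univ_inv_one_add_sq] at this
  refine this.trans (le_of_eq (by ring))

lemma JJ_value {c : ℝ} (h1 : -1/2 < c) (h2 : c < 0) (t : ℕ) : JJ c t = 2 * π * (√π : ℝ) := by
  rw [JJ_const h1 h2]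
  have h := JJ_neg_one_tendsto.add (res_tendsto.const_mul (2 * (π : ℂ)))
  rw [zero_add] at h
  refine tendsto_nhds_unique (f := fun _ : ℕ => JJ c 0) (l := atTop) tendsto_const_nhds ?_
  refine h.congr fun n => ?_
  rw [← JJ_residue h1 h2, JJ_const h1 h2]

lemma Gamma_pochR {a : ℝ} (ha : 0 < a) (n : ℕ) : Real.Gamma (a + n) = pochR a n * Real.Gamma a := by
  induction n with
  | zero => simp [pochR]
  | succ n ih =>
    have : a + n ≠ 0 := by positivity
    push_cast
    rw [← add_assoc, Real.Gamma_add_one this, ih, pochR, pochR, Finset.prod_range_succ]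
    ring

lemma pochR_pos {a : ℝ} (ha : 0 < a) (n : ℕ) : 0 < pochR a n :=
  Finset.prod_pos fun i _ => by positivity

lemma h6_eq {t : ℕ} {s : ℂ} (h1 : -1/2 < s.re) (h2 : s.re < 0) :
    h6 t s = ((pochR 1 t / (pochR (1/2) t * (π * √π)) : ℝ) : ℂ) * (gg t s / (s + 1/2)) := by
  have tn := t.cast_nonneg (α := ℝ)
  have n0 := ne_of_re (s := s) 0 (by linarith)
  have n1 := ne_of_re (s := s) (1/2) (by linarith)
  have n2 := ne_of_re (s := s) 1 (by linarith)
  push_cast at n0 n1 n2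
  rw [add_zero] at n0
  have e1 : Complex.Gamma (s + 3/2) = (s + 1/2) * Complex.Gamma (1/2 + s) := by
    rw [show s + 3/2 = s + 1/2 + 1 by ring, Complex.Gamma_add_one _ n1, add_comm s]
  have e2 : Complex.Gamma (s + 2) = (s + 1) * Complex.Gamma (1 + s) := by
    rw [show s + 2 = s + 1 + 1 by ring, Complex.Gamma_add_one _ n2, add_comm s]
  have e3 : Complex.Gamma (1 - s) = -s * Complex.Gamma (-s) := by
    rw [show 1 - s = -s + 1 by ring, Complex.Gamma_add_one _ (neg_ne_zero.mpr n0)]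
  have G1 : Complex.Gamma (1/2) = ((√π : ℝ) : ℂ) := by
    rw [← Real.Gamma_one_half_eq, ← Complex.Gamma_ofReal]; push_cast; rfl
  have G2 : Complex.Gamma (1/2 + t) = ((pochR (1/2) t * √π : ℝ) : ℂ) := by
    rw [← Real.Gamma_one_half_eq, ← Gamma_pochR (by norm_num), ← Complex.Gamma_ofReal]
    push_cast; rfl
  have G3 : Complex.Gamma (1 + 2 * t) = ((pochR (1/2) t * pochR 1 t * 4 ^ t : ℝ) : ℂ) := by
    have leg := Real.Gamma_mul_Gamma_add_half (1/2 + (t : ℝ))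
    rw [show 1/2 + (t:ℝ) + 1/2 = 1 + t by ring, show 2 * (1/2 + (t:ℝ)) = 1 + 2 * t by ring,
      Gamma_pochR (by norm_num), Gamma_pochR (by norm_num), Real.Gamma_one_half_eq,
      Real.Gamma_one, show (1 - (1 + 2 * (t:ℝ))) = -((2 * t : ℕ) : ℝ) by push_cast; ring,
      Real.rpow_neg (by norm_num), Real.rpow_natCast, pow_mul] at leg
    have g : √π ≠ 0 := by positivity
    have g' : (4:ℝ) ^ t ≠ 0 := by positivity
    norm_num at leg
    have : Real.Gamma (1 + 2 * t) = pochR (1/2) t * pochR 1 t * 4 ^ t := by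
      field_simp at leg
      norm_num at leg
      linear_combination -leg
    rw [← this, ← Complex.Gamma_ofReal]
    push_cast; rfl
  have q1 : ((pochR (1/2) t : ℝ) : ℂ) ≠ 0 := by exact_mod_cast (pochR_pos (by norm_num) t).ne'
  have q2 : ((√π : ℝ) : ℂ) ≠ 0 := by
    have : √π ≠ 0 := by positivity
    exact_mod_cast this
  have q3 : ((√π : ℝ) : ℂ) ^ 2 = (π : ℂ) := by
    rw [← Complex.ofReal_pow, Real.sq_sqrt Real.pi_pos.le]
  have q4 : (4 : ℂ) ^ t ≠ 0 := pow_ne_zero _ (by norm_num)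
  have q5 : ((pochR 1 t : ℝ) : ℂ) ≠ 0 := by exact_mod_cast (pochR_pos (by norm_num) t).ne'
  have g5 : Complex.Gamma (1 + s) ≠ 0 := Complex.Gamma_ne_zero_of_re_pos (by simp; linarith)
  have g6 : Complex.Gamma (s + 1 + 2 * t) ≠ 0 :=
    Complex.Gamma_ne_zero_of_re_pos (by simp; linarith)
  rw [h6, gg, PP, KK, e1, e2, e3]
  simp only [cpoch]
  rw [G1, G2, G3, Complex.Gamma_one, show (1/2 : ℂ) + t + s = s + 1/2 + t by ring,
    show (1 : ℂ) + 2 * t + s = s + 1 + 2 * t by ring]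
  push_cast
  rw [← q3]
  rw [show 3 * s + 2 * (t : ℂ) + 1 = 3 * s + (2 * t + 1) by ring]
  generalize Complex.Gamma (s + 1 + 2 * t) = A1 at *
  generalize Complex.Gamma (s + 1/2 + t) = A2 at *
  generalize Complex.Gamma (1 + s) = A3 at *
  generalize Complex.Gamma (1/2 + s) = A4 at *
  generalize Complex.Gamma (-s) = A5 at *
  generalize ((√π : ℝ) : ℂ) = S at *
  generalize ((pochR (1/2) t : ℝ) : ℂ) = B1 at *
  generalize ((pochR 1 t : ℝ) : ℂ) = B2 at *
  generalize (3 * s + (2 * (t : ℂ) + 1)) = L at *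
  generalize s + 1/2 = M at *
  generalize s + 1 = N at *
  field_simp

theorem barnes_integral_1_over_pi_param (t : ℕ) (c : ℝ) (hc1 : -1/2 < c) (hc2 : c < 0) :
    Integrable (fun y : ℝ => h6 t ((c : ℂ) + (y : ℂ) * Complex.I)) ∧
    (1 / (2*(π : ℂ))) * ∫ y : ℝ, h6 t ((c : ℂ) + (y : ℂ) * Complex.I) =
      ((1 / π) * pochR 1 t / pochR (1/2) t : ℝ) := by
  have e : (fun y : ℝ => h6 t ((c : ℂ) + (y : ℂ) * Complex.I)) = fun y : ℝ =>
      ((pochR 1 t / (pochR (1/2) t * (π * √π)) : ℝ) : ℂ) *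
      (gg t ((c : ℂ) + (y : ℂ) * Complex.I) / ((c : ℂ) + (y : ℂ) * Complex.I + 1/2)) := by
    ext y
    exact h6_eq (by simpa using hc1) (by simpa using hc2)
  rw [e]
  refine ⟨(int_gg hc1 hc2).const_mul _, ?_⟩
  have hJ := JJ_value hc1 hc2 t
  rw [JJ] at hJ
  rw [integral_const_mul, hJ]
  have hp : π ≠ 0 := Real.pi_ne_zero
  have hs : √π ≠ 0 := by positivity
  have hq : pochR (1/2) t ≠ 0 := (pochR_pos (by norm_num) t).ne'
  rw [show (1 / (2 * (π : ℂ))) * (((pochR 1 t / (pochR (1/2) t * (π * √π)) : ℝ) : ℂ) *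
    (2 * π * (√π : ℝ))) = ((1 / (2 * π) * ((pochR 1 t / (pochR (1/2) t * (π * √π))) *
    (2 * π * √π)) : ℝ) : ℂ) by push_cast; rfl]
  congr 1
  generalize pochR (1/2) t = B at *
  field_simp
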